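/- Fix an integer κ ≥ 2 and real numbers A, B, C, D, E, F with B ≥ 0, C ≥ 0, D ≥ 0, E ≥ 0, F ≥ 0. Let I = {(i,j) ∈ (Fin κ)² : i ≠ j} and define the matrix M : I × I → ℝ by, for row (a,c) ∈ I and column (b,d) ∈ I: M = A if b = a and d = c; M = C if b = c and d = a; M = B if b = a and d ≠ c; M = E if d = c and b ≠ a; M = D if (b = c and d ≠ a) or (d = a and b ≠ c); and M = F otherwise. If A − (C + (κ−2)·(B + 2D + E + (κ−3)·F)) > 0 (coefficients computed in ℝ), then M is positive definite; in particular M is invertible and rank M = κ(κ−1). -/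

import Mathlib

/-- The κ(κ−1)×κ(κ−1) matrix, indexed by ordered pairs of distinct states, with the
six-entry block pattern arising from the flattening of the Jukes–Cantor coalescent
site-pattern distribution along a non-valid split: for row `(a,c)` and column `(b,d)`,
the entry is `A` if `b = a ∧ d = c`, `C` if `b = c ∧ d = a`, `B` if `b = a ∧ d ≠ c`,
`E` if `d = c ∧ b ≠ a`, `D` if `(b = c ∧ d ≠ a) ∨ (d = a ∧ b ≠ c)`, and `F` otherwise. -/
def blockMat (κ : ℕ) (A B C D E F : ℝ) :
    Matrix {p : Fin κ × Fin κ // p.1 ≠ p.2} {p : Fin κ × Fin κ // p.1 ≠ p.2} ℝ :=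
  fun r c =>
    if c.1.1 = r.1.1 ∧ c.1.2 = r.1.2 then A
    else if c.1.1 = r.1.2 ∧ c.1.2 = r.1.1 then C
    else if c.1.1 = r.1.1 then B
    else if c.1.2 = r.1.2 then E
    else if c.1.1 = r.1.2 ∨ c.1.2 = r.1.1 then D
    else F

theorem blockMat_entry (κ : ℕ) (A B C D E F : ℝ) (a c b d : Fin κ) (h : a ≠ c) (h' : b ≠ d) :
    blockMat κ A B C D E F ⟨(a, c), h⟩ ⟨(b, d), h'⟩ =
      F + (B - F) * (if b = a then 1 else 0) + (E - F) * (if d = c then 1 else 0)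
        + (D - F) * (if b = c then 1 else 0) + (D - F) * (if d = a then 1 else 0)
        + (A - B - E + F) * ((if b = a then 1 else 0) * (if d = c then 1 else 0))
        + (C - 2 * D + F) * ((if b = c then 1 else 0) * (if d = a then 1 else 0)) := by
  unfold blockMat
  dsimp only
  split_ifs <;> first | ring1 | (exfalso; grind)

theorem blockMat_rowsum (κ : ℕ) (A B C D E F : ℝ) (r : {p : Fin κ × Fin κ // p.1 ≠ p.2}) :
    ∑ p, blockMat κ A B C D E F r p =
      A + (C + ((κ : ℝ) - 2) * (B + 2 * D + E + ((κ : ℝ) - 3) * F)) := by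
  obtain ⟨⟨a, c⟩, h⟩ := r
  let g : Fin κ × Fin κ → ℝ := fun p =>
      F + (B - F) * (if p.1 = a then 1 else 0) + (E - F) * (if p.2 = c then 1 else 0)
        + (D - F) * (if p.1 = c then 1 else 0) + (D - F) * (if p.2 = a then 1 else 0)
        + (A - B - E + F) * ((if p.1 = a then 1 else 0) * (if p.2 = c then 1 else 0))
        + (C - 2 * D + F) * ((if p.1 = c then 1 else 0) * (if p.2 = a then 1 else 0))
  have h1 : ∑ p, blockMat κ A B C D E F ⟨(a, c), h⟩ p
      = ∑ p : {p : Fin κ × Fin κ // p.1 ≠ p.2}, g p.1 := by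
    refine Finset.sum_congr rfl ?_
    rintro ⟨⟨b, d⟩, h'⟩ -
    exact blockMat_entry κ A B C D E F a c b d h h'
  have h2 : ∑ p : {p : Fin κ × Fin κ // p.1 ≠ p.2}, g p.1
      = ∑ p : Fin κ × Fin κ, if p.1 ≠ p.2 then g p else 0 := by
    rw [← Finset.sum_filter]
    exact (Finset.sum_subtype _ (by simp) g).symm
  have h3 : ∑ p : Fin κ × Fin κ, (if p.1 ≠ p.2 then g p else 0)
      = ∑ b, ∑ d, g (b, d) - ∑ b, g (b, b) := by
    rw [Fintype.sum_prod_type, ← Finset.sum_sub_distrib]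
    refine Finset.sum_congr rfl fun b _ => ?_
    have : g (b, b) = ∑ d, if b = d then g (b, d) else 0 := by simp
    rw [this, ← Finset.sum_sub_distrib]
    refine Finset.sum_congr rfl fun d _ => ?_
    by_cases hbd : b = d <;> simp [hbd]
  rw [h1, h2, h3]
  have hca : c ≠ a := Ne.symm h
  have e : a ≠ c := h
  simp only [g, Finset.sum_add_distrib, ← Finset.mul_sum]
  have hs : ∀ t : Fin κ, ∑ x : Fin κ, ∑ _y : Fin κ, (if x = t then (1 : ℝ) else 0) = κ := by
    intro t
    rw [Finset.sum_comm]
    simp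
  rw [hs, hs]
  simp [e, hca]
  ring

theorem blockMat_isHermitian (κ : ℕ) (A B C D E F : ℝ) :
    (blockMat κ A B C D E F).IsHermitian := by
  ext ⟨⟨a, c⟩, h⟩ ⟨⟨b, d⟩, h'⟩
  simp only [Matrix.conjTranspose_apply, star_trivial]
  rw [blockMat_entry, blockMat_entry]
  simp only [eq_comm (a := a), eq_comm (a := c)]
  ring

/-- if the off-diagonal entries are nonnegative and the strict diagonal
dominance inequality `A − (C + (κ−2)(B + 2D + E + (κ−3)F)) > 0` holds, then the block
matrix is positive definite; in particular it is invertible and has full rank `κ(κ−1)`. -/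
theorem blockMat_posDef (κ : ℕ) (hκ : 2 ≤ κ) (A B C D E F : ℝ)
    (hB : 0 ≤ B) (hC : 0 ≤ C) (hD : 0 ≤ D) (hE : 0 ≤ E) (hF : 0 ≤ F)
    (hdom : A - (C + ((κ : ℝ) - 2) * (B + 2 * D + E + ((κ : ℝ) - 3) * F)) > 0) :
    (blockMat κ A B C D E F).PosDef ∧ IsUnit (blockMat κ A B C D E F).det ∧
      (blockMat κ A B C D E F).rank = κ * (κ - 1) := by
  have hH := blockMat_isHermitian κ A B C D E F
  have hdiag : ∀ k, blockMat κ A B C D E F k k = A := fun k => by simp [blockMat]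
  have hoff : ∀ k, ∑ j ∈ Finset.univ.erase k, ‖blockMat κ A B C D E F k j‖ < A := by
    intro k
    have h1 : ∑ j ∈ Finset.univ.erase k, ‖blockMat κ A B C D E F k j‖
        = ∑ j ∈ Finset.univ.erase k, blockMat κ A B C D E F k j := by
      refine Finset.sum_congr rfl fun j hj => ?_
      rw [Real.norm_eq_abs, abs_of_nonneg]
      have hne : ¬ (j.1.1 = k.1.1 ∧ j.1.2 = k.1.2) := fun hh =>
        (Finset.ne_of_mem_erase hj) (Subtype.ext (Prod.ext hh.1 hh.2))
      unfold blockMat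
      rw [if_neg hne]
      split_ifs <;> assumption
    have h2 := blockMat_rowsum κ A B C D E F k
    rw [← Finset.add_sum_erase _ _ (Finset.mem_univ k), hdiag] at h2
    rw [h1]
    linarith
  have hpd : (blockMat κ A B C D E F).PosDef := by
    rw [hH.posDef_iff_eigenvalues_pos]
    intro i
    have hev : Module.End.HasEigenvalue (Matrix.toLin' (blockMat κ A B C D E F))
        (hH.eigenvalues i) := by
      rw [Module.End.hasEigenvalue_iff_mem_spectrum, Matrix.spectrum_toLin']
      exact hH.eigenvalues_mem_spectrum_real i
    obtain ⟨k, hk⟩ := eigenvalue_mem_ball hev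
    rw [hdiag, Metric.mem_closedBall, Real.dist_eq] at hk
    have := (abs_le.1 hk).1
    have := hoff k
    linarith
  have hdet : IsUnit (blockMat κ A B C D E F).det := hpd.det_pos.ne'.isUnit
  refine ⟨hpd, hdet, ?_⟩
  rw [Matrix.rank_of_isUnit _ ((Matrix.isUnit_iff_isUnit_det _).2 hdet)]
  have hc := Fintype.card_subtype_compl (fun p : Fin κ × Fin κ => p.1 = p.2)
  have hd : Fintype.card {p : Fin κ × Fin κ // p.1 = p.2} = κ := by
    rw [Fintype.card_congr (β := Fin κ)
      ⟨fun p => p.1.1, fun a => ⟨(a, a), rfl⟩, fun ⟨⟨a, b⟩, h⟩ => by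
        simp only at h; subst h; rfl, fun a => rfl⟩]
    simp
  rw [hd] at hc
  simp only [Fintype.card_prod, Fintype.card_fin] at hc
  rw [Nat.mul_sub, mul_one, ← hc]
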